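/- Let t₀ ≥ 1, φ₁ ≠ 0, and d₀ be real numbers. Then there exists ρ ∈ (0, 1) with φ₁ t₀^{ρ−1} / Γ(ρ) = d₀ if and only if 0 < d₀/φ₁ < 1; moreover, when it exists, such ρ is unique. -/

import Mathlib

/-- For `t ≥ 1`, the function `ρ ↦ t ^ (ρ - 1) / Γ(ρ)` is strictly increasing on `(0, 1]`. -/
lemma strictMonoOn_rpow_sub_one_div_Gamma {t : ℝ} (ht : 1 ≤ t) :
    StrictMonoOn (fun ρ : ℝ => t ^ (ρ - 1) / Real.Gamma ρ) (Set.Ioc 0 1) := by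
  intro x hx y hy hxy
  exact div_lt_div₀' (Real.rpow_le_rpow_of_exponent_le ht (by linarith))
    (Real.Gamma_strictAntiOn_Ioc hx hy hxy) (Real.rpow_pos_of_pos (by linarith) _)
    (Real.Gamma_pos_of_pos hy.1)

/-- The functional equation of `Γ`, which also holds at `ρ = 0` because of the junk value
`Γ(0) = 0`, removes the singularity at `0`. -/
lemma continuousOn_rpow_sub_one_div_Gamma {t : ℝ} (ht : 0 < t) :
    ContinuousOn (fun ρ : ℝ => t ^ (ρ - 1) / Real.Gamma ρ) (Set.Ici 0) := by
  have h : ContinuousOn (fun ρ : ℝ => t ^ (ρ - 1) * ρ / Real.Gamma (ρ + 1)) (Set.Ici 0) := by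
    refine ContinuousOn.div ?_ ?_ fun ρ hρ => ?_
    · exact ((continuous_const.rpow (continuous_id.sub continuous_const)
        fun _ => Or.inl ht.ne').mul continuous_id).continuousOn
    · refine Real.differentiableOn_Gamma_Ioi.continuousOn.comp (by fun_prop) fun ρ hρ => ?_
      simp only [Set.mem_Ici, Set.mem_Ioi] at hρ ⊢
      linarith
    · exact (Real.Gamma_pos_of_pos (by linarith [Set.mem_Ici.mp hρ])).ne'
  refine h.congr fun ρ _ => ?_
  rcases eq_or_ne ρ 0 with rfl | h0
  · simp
  · simp only [Real.Gamma_add_one h0]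
    rw [mul_comm ρ, mul_div_mul_right _ _ h0]

/-- **Theorem 2.1 of the paper, scalar content.** Let `t₀ ≥ 1`, `φ₁ ≠ 0`, and
`d₀` be real numbers. Then there exists `ρ ∈ (0, 1)` with `φ₁ t₀^{ρ−1} / Γ(ρ) = d₀` if and
only if `0 < d₀/φ₁ < 1`; moreover, when it exists, such `ρ` is unique. -/
theorem exists_order_iff (t₀ φ₁ d₀ : ℝ) (ht₀ : 1 ≤ t₀) (hφ₁ : φ₁ ≠ 0) :
    ((∃ ρ ∈ Set.Ioo (0 : ℝ) 1, φ₁ * (t₀ ^ (ρ - 1) / Real.Gamma ρ) = d₀) ↔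
      (0 < d₀ / φ₁ ∧ d₀ / φ₁ < 1)) ∧
    (∀ ρ₁ ∈ Set.Ioo (0 : ℝ) 1, ∀ ρ₂ ∈ Set.Ioo (0 : ℝ) 1,
      φ₁ * (t₀ ^ (ρ₁ - 1) / Real.Gamma ρ₁) = d₀ →
      φ₁ * (t₀ ^ (ρ₂ - 1) / Real.Gamma ρ₂) = d₀ → ρ₁ = ρ₂) := by
  have ht : 0 < t₀ := by linarith
  have hmono := strictMonoOn_rpow_sub_one_div_Gamma ht₀
  have heq (ρ : ℝ) : φ₁ * (t₀ ^ (ρ - 1) / Real.Gamma ρ) = d₀ ↔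
      t₀ ^ (ρ - 1) / Real.Gamma ρ = d₀ / φ₁ := by
    rw [eq_div_iff hφ₁, mul_comm]
  simp only [heq]
  refine ⟨⟨?_, fun hd => ?_⟩, fun ρ₁ h₁ ρ₂ h₂ e₁ e₂ => ?_⟩
  · rintro ⟨ρ, hρ, h⟩
    rw [← h]
    refine ⟨div_pos (Real.rpow_pos_of_pos ht _) (Real.Gamma_pos_of_pos hρ.1), ?_⟩
    simpa using hmono ⟨hρ.1, hρ.2.le⟩ ⟨one_pos, le_rfl⟩ hρ.2
  · have hivt := intermediate_value_Ioo zero_le_one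
      ((continuousOn_rpow_sub_one_div_Gamma ht).mono Set.Icc_subset_Ici_self)
    exact hivt (by simpa using hd)
  · exact hmono.injOn ⟨h₁.1, h₁.2.le⟩ ⟨h₂.1, h₂.2.le⟩ (e₁.trans e₂.symm)
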